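/- arXiv:2505.07308 — 2 statements merged into one kernel-verified Lean document; each statement's English description precedes it below -/
import Mathlib

section
/- Let A be a symmetric n × n real matrix all of whose diagonal entries are zero, let G_a be its adjacency graph, and let φ : {1,…,n} → ℕ be a coloring (0 being the neutral color). If the partition P_φ is a neutralized symmetrically orthogonal partition of the columns of A, then φ is a no-zig-zag coloring of G_a. -/
/-- `i` and `j` are adjacent in the adjacency graph of `A`. -/
def IsEdge {n : ℕ} (A : Matrix (Fin n) (Fin n) ℝ) (i j : Fin n) : Prop :=
  i ≠ j ∧ A i j ≠ 0

/-- `φ` is a no-zig-zag coloring of the adjacency graph of `A`, with `0` the neutral color. -/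
def NoZigZag {n : ℕ} (A : Matrix (Fin n) (Fin n) ℝ) (φ : Fin n → ℕ) : Prop :=
  (∀ i j : Fin n, IsEdge A i j → 0 < φ i ∨ 0 < φ j) ∧
  (∀ i j q : Fin n, φ i = 0 → j ≠ q → IsEdge A i j → IsEdge A i q → φ j ≠ φ q) ∧
  (∀ q i j p : Fin n, q ≠ i → q ≠ j → q ≠ p → i ≠ j → i ≠ p → j ≠ p →
    IsEdge A q i → IsEdge A i j → IsEdge A j p → φ q ≠ φ j ∨ φ i ≠ φ p)

/-- The partition induced by `φ` is a neutralized symmetrically orthogonal partition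
of the columns of `A`. -/
def NeutralizedSymOrth {n : ℕ} (A : Matrix (Fin n) (Fin n) ℝ) (φ : Fin n → ℕ) : Prop :=
  ∀ i j : Fin n, A i j ≠ 0 →
    (0 < φ j ∧ ∀ k : Fin n, φ k = φ j → A i k ≠ 0 → k = j) ∨
    (0 < φ i ∧ ∀ k : Fin n, φ k = φ i → A j k ≠ 0 → k = i)

theorem neutralized_sym_orth_implies_no_zig_zag {n : ℕ} (A : Matrix (Fin n) (Fin n) ℝ)
    (hsym : ∀ i j : Fin n, A i j = A j i) (hdiag : ∀ i : Fin n, A i i = 0)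
    (φ : Fin n → ℕ) (hφ : NeutralizedSymOrth A φ) :
    NoZigZag A φ := by
  refine ⟨fun i j h => ?_, fun i j q hi hjq hij hiq hc => ?_,
    fun q i j p _ hqj _ _ hip _ hqi hij hjp => ?_⟩
  · rcases hφ i j h.2 with h | h
    · exact Or.inr h.1
    · exact Or.inl h.1
  · rcases hφ i j hij.2 with h | h
    · exact hjq (h.2 q hc.symm hiq.2).symm
    · exact h.1.ne' hi
  · by_contra! hc
    rcases hφ i j hij.2 with h | h
    · exact hqj (h.2 q hc.1 (hsym q i ▸ hqi.2))
    · exact hip (h.2 p hc.2.symm hjp.2).symm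
end

section
/- Let A be an m × n real matrix and let φ : {1,…,n} → ℕ be a coloring of its columns such that any two distinct columns with the same color are structurally orthogonal, i.e., for all distinct j, k with φ(j) = φ(k) and all rows i, A_ij = 0 or A_ik = 0. Then every nonzero entry of A can be read directly from the column-compressed matrix: for every pair (i,j) with A_ij ≠ 0, the sum over all columns k with φ(k) = φ(j) of A_ik equals A_ij. -/
theorem direct_recovery_column_coloring {m n : ℕ} (A : Matrix (Fin m) (Fin n) ℝ)
    (φ : Fin n → ℕ)
    (horth : ∀ j k : Fin n, j ≠ k → φ j = φ k → ∀ i : Fin m, A i j = 0 ∨ A i k = 0) :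
    ∀ i : Fin m, ∀ j : Fin n, A i j ≠ 0 →
      ∑ k ∈ Finset.univ.filter (fun k => φ k = φ j), A i k = A i j := by
  intro i j hij
  refine Finset.sum_eq_single_of_mem j (by simp) fun k hk hkj => ?_
  exact (horth j k hkj.symm (Finset.mem_filter.mp hk).2.symm i).resolve_left hij
end
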